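/- arXiv:2108.06406 — 2 statements merged into one kernel-verified Lean document; each statement's English description precedes it below -/
import Mathlib

section
/- Let (X,Σ,μ) be a measure space and M = L∞(X,Σ,μ). (a) For every countably additive (equivalently, σ-normal) weight ω on M₊ there exists a measure ν on (X,Σ) with ν ≪ μ such that ω(f) = ∫ f dν for all f ∈ M₊, i.e. ω = ψ_ν. (b) The assignment ν ↦ ψ_ν is a bijection between the measures ν on (X,Σ) with ν ≪ μ and the countably additive weights on M₊. (c) ψ_ν is faithful if and only if μ ≪ ν (so μ and ν are mutually absolutely continuous), and in this case ψ_ν is completely additive. -/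
open MeasureTheory ENNReal NNReal Set Filter

noncomputable section

namespace Paper

variable {X : Type} [MeasurableSpace X]

/-- A measure is *semifinite* if every measurable set of infinite measure has a measurable
subset of strictly positive finite measure. -/
def Semifinite (μ : Measure X) : Prop :=
  ∀ E, MeasurableSet E → μ E = ∞ →
    ∃ F, MeasurableSet F ∧ F ⊆ E ∧ 0 < μ F ∧ μ F < ∞

/-- A measure space is *Dedekind* if every family of measurable sets has an essential
supremum. -/
def Dedekind (μ : Measure X) : Prop :=
  ∀ 𝒞 : Set (Set X), (∀ C ∈ 𝒞, MeasurableSet C) →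
    ∃ S, MeasurableSet S ∧ (∀ C ∈ 𝒞, μ (C \ S) = 0) ∧
      ∀ T, MeasurableSet T → (∀ C ∈ 𝒞, μ (C \ T) = 0) → μ (S \ T) = 0

/-- A measure space is *localizable* if it is semifinite and Dedekind. -/
def Localizable (μ : Measure X) : Prop := Semifinite μ ∧ Dedekind μ

/-- A measure space is *dualizable* if the canonical map `L∞ → (L¹)*`,
`f ↦ (g ↦ ∫ f g dμ)`, is an isometric isomorphism: it is norm-preserving (the operator
norm of the induced functional is `‖f‖`) and every continuous functional on `L¹` arises
this way. -/
def Dualizable (μ : Measure X) : Prop :=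
  (∀ f : Lp ℝ ∞ μ,
    ‖f‖ = sSup ((fun g : Lp ℝ 1 μ => |∫ x, f x * g x ∂μ|) '' {g | ‖g‖ ≤ 1})) ∧
  (∀ φ : Lp ℝ 1 μ →L[ℝ] ℝ, ∃ f : Lp ℝ ∞ μ, ∀ g : Lp ℝ 1 μ, φ g = ∫ x, f x * g x ∂μ)

/-- A *weight* on `L∞(μ)₊`: an additive, `[0,∞]`-positively-homogeneous map on the
positive cone, with values in `[0,∞]`. -/
def IsWeight (μ : Measure X) (ω : Lp ℝ ∞ μ → ℝ≥0∞) : Prop :=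
  (∀ f g : Lp ℝ ∞ μ, 0 ≤ f → 0 ≤ g → ω (f + g) = ω f + ω g) ∧
  (∀ (t : ℝ≥0) (f : Lp ℝ ∞ μ), 0 ≤ f → ω ((t : ℝ) • f) = (t : ℝ≥0∞) * ω f)

/-- A weight is *normal* if it preserves suprema of increasing nets (equivalently,
upward-directed sets) of positive elements possessing a supremum. -/
def NormalWeight (μ : Measure X) (ω : Lp ℝ ∞ μ → ℝ≥0∞) : Prop :=
  ∀ s : Set (Lp ℝ ∞ μ), s.Nonempty → DirectedOn (· ≤ ·) s → (∀ f ∈ s, 0 ≤ f) →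
    ∀ g, IsLUB s g → ω g = ⨆ f ∈ s, ω f

/-- A weight is *completely additive* if `ω f = ∑ᵢ ω fᵢ` whenever `(fᵢ)` is a family of
positive elements whose finite partial sums are uniformly bounded and have supremum `f`. -/
def CompletelyAdditiveWeight (μ : Measure X) (ω : Lp ℝ ∞ μ → ℝ≥0∞) : Prop :=
  ∀ (ι : Type) (f : ι → Lp ℝ ∞ μ), (∀ i, 0 ≤ f i) →
    (∃ C : ℝ, ∀ J : Finset ι, ‖∑ i ∈ J, f i‖ ≤ C) →
    ∀ g, IsLUB (Set.range fun J : Finset ι => ∑ i ∈ J, f i) g →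
      ω g = ∑' i, ω (f i)

/-- A weight is *countably additive* (equivalently, σ-normal) if the above holds for
countable families. -/
def CountablyAdditiveWeight (μ : Measure X) (ω : Lp ℝ ∞ μ → ℝ≥0∞) : Prop :=
  ∀ f : ℕ → Lp ℝ ∞ μ, (∀ i, 0 ≤ f i) →
    (∃ C : ℝ, ∀ J : Finset ℕ, ‖∑ i ∈ J, f i‖ ≤ C) →
    ∀ g, IsLUB (Set.range fun J : Finset ℕ => ∑ i ∈ J, f i) g →
      ω g = ∑' i, ω (f i)

/-- For a measure `ν` (intended: `ν ≪ μ`), the weight `ψ_ν(f) = ∫ f dν` on `L∞(μ)₊`. -/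
def psiW (μ ν : Measure X) (f : Lp ℝ ∞ μ) : ℝ≥0∞ := ∫⁻ x, ENNReal.ofReal (f x) ∂ν

/-- A projection in `L∞(μ)`: the a.e.-class of the indicator function of a measurable set. -/
def IsProjection (μ : Measure X) (p : Lp ℝ ∞ μ) : Prop :=
  ∃ E, MeasurableSet E ∧ (p : X → ℝ) =ᵐ[μ] E.indicator 1

/-- A weight is *semifinite* if every projection of infinite weight dominates a
projection of strictly positive finite weight. -/
def SemifiniteWeight (μ : Measure X) (ω : Lp ℝ ∞ μ → ℝ≥0∞) : Prop :=
  ∀ p, IsProjection μ p → ω p = ∞ →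
    ∃ q, IsProjection μ q ∧ q ≤ p ∧ 0 < ω q ∧ ω q < ∞

/-- A weight is *faithful* if it vanishes only at `0` among positive elements. -/
def FaithfulWeight (μ : Measure X) (ω : Lp ℝ ∞ μ → ℝ≥0∞) : Prop :=
  ∀ f : Lp ℝ ∞ μ, 0 ≤ f → ω f = 0 → f = 0

/-- `ν` has *μ-support* `E₀`. -/
def HasMuSupport (μ ν : Measure X) : Prop :=
  ∃ E₀, MeasurableSet E₀ ∧ (∀ E, MeasurableSet E → ν E = ν (E ∩ E₀)) ∧
    ∀ E, MeasurableSet E → E ⊆ E₀ → 0 < μ E → 0 < ν E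

/-- `ν` is *μ-semifinite*. -/
def MuSemifinite (μ ν : Measure X) : Prop :=
  ∀ E, MeasurableSet E → 0 < ν E →
    ∃ F, MeasurableSet F ∧ F ⊆ E ∧ μ F < ∞ ∧ 0 < ν F

/-- `ν` is *strongly μ-semifinite*. -/
def StronglyMuSemifinite (μ ν : Measure X) : Prop :=
  ∀ E, MeasurableSet E → 0 < ν E →
    ∃ F, MeasurableSet F ∧ F ⊆ E ∧ μ F < ∞ ∧ 0 < ν F ∧ ν F < ∞

end Paper

open Paper MeasureTheory

namespace Paper

variable {X : Type} [MeasurableSpace X] {μ ν : Measure X}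

/-- Almost everywhere, taking finite sums of nonnegative elements of `L∞` commutes with
`ENNReal.ofReal`, simultaneously for all finite index sets. -/
theorem ae_forall_ofReal_sum {ι : Type} [Countable ι] {f : ι → Lp ℝ ∞ μ} (hf : ∀ i, 0 ≤ f i) :
    ∀ᵐ x ∂μ, ∀ J : Finset ι,
      ENNReal.ofReal ((∑ i ∈ J, f i : Lp ℝ ∞ μ) x) = ∑ i ∈ J, ENNReal.ofReal (f i x) := by
  have hnonneg : ∀ᵐ x ∂μ, ∀ i, 0 ≤ f i x :=
    ae_all_iff.2 fun i => (Lp.coeFn_nonneg (f i)).2 (hf i)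
  have hsum : ∀ᵐ x ∂μ, ∀ J : Finset ι, (∑ i ∈ J, f i : Lp ℝ ∞ μ) x = ∑ i ∈ J, f i x := by
    refine ae_all_iff.2 fun J => ?_
    filter_upwards [Lp.coeFn_finsetSum J f] with x hx
    simpa using hx
  filter_upwards [hnonneg, hsum] with x h₁ h₂ J
  rw [h₂ J, ENNReal.ofReal_sum_of_nonneg fun i _ => h₁ i]

/-- A supremum in `L∞` of the finite partial sums of a countable nonnegative family is almost
everywhere the pointwise sum. -/
theorem ae_ofReal_eq_tsum_of_isLUB {ι : Type} [Countable ι] {f : ι → Lp ℝ ∞ μ}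
    (hf : ∀ i, 0 ≤ f i) {g : Lp ℝ ∞ μ}
    (hg : IsLUB (Set.range fun J : Finset ι => ∑ i ∈ J, f i) g) :
    ∀ᵐ x ∂μ, ENNReal.ofReal (g x) = ∑' i, ENNReal.ofReal (f i x) := by
  have hle : ∀ᵐ x ∂μ, ∑' i, ENNReal.ofReal (f i x) ≤ ENNReal.ofReal (g x) := by
    have hub : ∀ᵐ x ∂μ, ∀ J : Finset ι, (∑ i ∈ J, f i : Lp ℝ ∞ μ) x ≤ g x :=
      ae_all_iff.2 fun J => (Lp.coeFn_le _ _).2 (hg.1 ⟨J, rfl⟩)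
    filter_upwards [ae_forall_ofReal_sum hf, hub] with x h₁ h₂
    rw [ENNReal.tsum_eq_iSup_sum]
    exact iSup_le fun J => h₁ J ▸ ENNReal.ofReal_le_ofReal (h₂ J)
  have hmeas : Measurable fun x => (∑' i, ENNReal.ofReal (f i x)).toReal :=
    (Measurable.tsum fun i => (Lp.stronglyMeasurable (f i)).measurable.ennreal_ofReal).ennreal_toReal
  have hmem : MemLp (fun x => (∑' i, ENNReal.ofReal (f i x)).toReal) ∞ μ := by
    refine (Lp.memLp g).of_le hmeas.aestronglyMeasurable ?_
    filter_upwards [hle] with x hx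
    rw [Real.norm_of_nonneg ENNReal.toReal_nonneg]
    refine (ENNReal.toReal_mono ENNReal.ofReal_ne_top hx).trans ?_
    rw [ENNReal.toReal_ofReal']
    exact max_le (Real.le_norm_self _) (norm_nonneg _)
  have hgle : g ≤ hmem.toLp _ := by
    refine hg.2 ?_
    rintro _ ⟨J, rfl⟩
    rw [← Lp.coeFn_le]
    filter_upwards [ae_forall_ofReal_sum hf, hle, hmem.coeFn_toLp] with x h₁ h₂ h₃
    rw [h₃, ← ENNReal.ofReal_le_iff_le_toReal (h₂.trans_lt ENNReal.ofReal_lt_top).ne]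
    exact (h₁ J).trans_le (ENNReal.sum_le_tsum J)
  filter_upwards [hle, hmem.coeFn_toLp, (Lp.coeFn_le _ _).2 hgle] with x h₁ h₂ h₃
  refine le_antisymm ?_ h₁
  rw [ENNReal.ofReal_le_iff_le_toReal (h₁.trans_lt ENNReal.ofReal_lt_top).ne]
  exact h₃.trans_eq h₂

theorem CountablyAdditiveWeight.eq_tsum {ω : Lp ℝ ∞ μ → ℝ≥0∞} (hω : CountablyAdditiveWeight μ ω)
    {f : ℕ → Lp ℝ ∞ μ} (hf : ∀ i, 0 ≤ f i) {g : Lp ℝ ∞ μ} (hg : 0 ≤ g)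
    (h : ∀ᵐ x ∂μ, ENNReal.ofReal (g x) = ∑' i, ENNReal.ofReal (f i x)) :
    ω g = ∑' i, ω (f i) := by
  have hg' := (Lp.coeFn_nonneg g).2 hg
  have hub : ∀ J : Finset ℕ, ∑ i ∈ J, f i ≤ g := by
    intro J
    rw [← Lp.coeFn_le]
    filter_upwards [ae_forall_ofReal_sum hf, h, hg'] with x h₁ h₂ h₃
    rw [← ENNReal.ofReal_le_ofReal_iff h₃, h₁ J, h₂]
    exact ENNReal.sum_le_tsum J
  refine hω f hf ⟨‖g‖, fun J => ?_⟩ g ⟨?_, fun k hk => ?_⟩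
  · refine Lp.norm_le_norm_of_ae_le ?_
    filter_upwards [(Lp.coeFn_le _ _).2 (hub J), hg',
      (Lp.coeFn_nonneg _).2 (Finset.sum_nonneg fun i (_ : i ∈ J) => hf i)] with x h₁ h₂ h₃
    rw [Real.norm_of_nonneg h₂, Real.norm_of_nonneg h₃]
    exact h₁
  · rintro _ ⟨J, rfl⟩
    exact hub J
  · have hk' : ∀ᵐ x ∂μ, ∀ J : Finset ℕ, (∑ i ∈ J, f i : Lp ℝ ∞ μ) x ≤ k x :=
      ae_all_iff.2 fun J => (Lp.coeFn_le _ _).2 (hk ⟨J, rfl⟩)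
    have hk₀ : 0 ≤ k := by simpa using hk ⟨∅, rfl⟩
    rw [← Lp.coeFn_le]
    filter_upwards [ae_forall_ofReal_sum hf, h, hk', (Lp.coeFn_nonneg k).2 hk₀] with x h₁ h₂ h₃ h₄
    rw [← ENNReal.ofReal_le_ofReal_iff h₄, h₂, ENNReal.tsum_eq_iSup_sum]
    exact iSup_le fun J => h₁ J ▸ ENNReal.ofReal_le_ofReal (h₃ J)

theorem IsWeight.map_zero {ω : Lp ℝ ∞ μ → ℝ≥0∞} (hω : IsWeight μ ω) : ω 0 = 0 := by
  simpa using hω.2 0 0 le_rfl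

variable (μ) in
/-- The class in `L∞(μ)` of a nonnegative simple function. -/
def simpleLp (φ : SimpleFunc X ℝ≥0) : Lp ℝ ∞ μ :=
  ((φ.map ((↑) : ℝ≥0 → ℝ)).memLp_top μ).toLp _

theorem coeFn_simpleLp (φ : SimpleFunc X ℝ≥0) : ∀ᵐ x ∂μ, simpleLp μ φ x = φ x :=
  MemLp.coeFn_toLp ((φ.map ((↑) : ℝ≥0 → ℝ)).memLp_top μ)

theorem ofReal_simpleLp (φ : SimpleFunc X ℝ≥0) :
    ∀ᵐ x ∂μ, ENNReal.ofReal (simpleLp μ φ x) = φ x := by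
  filter_upwards [coeFn_simpleLp φ] with x hx
  rw [hx, ENNReal.ofReal_coe_nnreal]

theorem simpleLp_nonneg (φ : SimpleFunc X ℝ≥0) : 0 ≤ simpleLp μ φ := by
  rw [← Lp.coeFn_nonneg]
  filter_upwards [coeFn_simpleLp φ] with x hx
  simp [hx]

theorem simpleLp_add (φ ψ : SimpleFunc X ℝ≥0) :
    simpleLp μ (φ + ψ) = simpleLp μ φ + simpleLp μ ψ := by
  refine Lp.ext ?_
  filter_upwards [coeFn_simpleLp (μ := μ) φ, coeFn_simpleLp (μ := μ) ψ,
    coeFn_simpleLp (μ := μ) (φ + ψ), Lp.coeFn_add (simpleLp μ φ) (simpleLp μ ψ)] with x h₁ h₂ h₃ h₄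
  rw [h₃, h₄, Pi.add_apply, h₁, h₂, SimpleFunc.add_apply, NNReal.coe_add]

variable (μ) in
/-- The class in `L∞(μ)` of the indicator function of a measurable set. -/
def indicatorLp (E : Set X) (hE : MeasurableSet E) : Lp ℝ ∞ μ :=
  simpleLp μ (.piecewise E hE (.const X 1) (.const X 0))

theorem indicatorLp_nonneg {E : Set X} (hE : MeasurableSet E) : 0 ≤ indicatorLp μ E hE :=
  simpleLp_nonneg _

theorem ofReal_indicatorLp {E : Set X} (hE : MeasurableSet E) :
    ∀ᵐ x ∂μ, ENNReal.ofReal (indicatorLp μ E hE x) = E.indicator 1 x := by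
  filter_upwards [ofReal_simpleLp (μ := μ) (.piecewise E hE (.const X 1) (.const X 0))] with x hx
  rw [indicatorLp, hx]
  by_cases h : x ∈ E <;> simp [h]

theorem simpleLp_piecewise_const (c : ℝ≥0) {E : Set X} (hE : MeasurableSet E) :
    simpleLp μ (.piecewise E hE (.const X c) (.const X 0)) = (c : ℝ) • indicatorLp μ E hE := by
  refine Lp.ext ?_
  filter_upwards [coeFn_simpleLp (μ := μ) (.piecewise E hE (.const X c) (.const X 0)),
    coeFn_simpleLp (μ := μ) (.piecewise E hE (.const X 1) (.const X 0)),
    Lp.coeFn_smul (c : ℝ) (indicatorLp μ E hE)] with x h₁ h₂ h₃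
  rw [h₁, h₃, Pi.smul_apply, indicatorLp, h₂]
  by_cases h : x ∈ E <;> simp [h]

theorem indicatorLp_eq_zero_iff {E : Set X} (hE : MeasurableSet E) :
    indicatorLp μ E hE = 0 ↔ μ E = 0 := by
  rw [Lp.eq_zero_iff_ae_eq_zero, measure_eq_zero_iff_ae_notMem]
  refine ⟨fun h => ?_, fun h => ?_⟩
  · filter_upwards [h, ofReal_indicatorLp (μ := μ) hE] with x h₁ h₂ hx
    simp [h₁, hx] at h₂
  · filter_upwards [h, ofReal_indicatorLp (μ := μ) hE,
      (Lp.coeFn_nonneg _).2 (indicatorLp_nonneg (μ := μ) hE)] with x h₁ h₂ h₃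
    refine le_antisymm ?_ h₃
    simpa [h₁] using h₂

theorem psiW_indicatorLp (h : ν ≪ μ) {E : Set X} (hE : MeasurableSet E) :
    psiW μ ν (indicatorLp μ E hE) = ν E := by
  rw [psiW, lintegral_congr_ae (h.ae_le (ofReal_indicatorLp hE)), lintegral_indicator_one hE]

theorem psiW_eq_tsum_of_isLUB (h : ν ≪ μ) {ι : Type} [Countable ι] {f : ι → Lp ℝ ∞ μ}
    (hf : ∀ i, 0 ≤ f i) {g : Lp ℝ ∞ μ}
    (hg : IsLUB (Set.range fun J : Finset ι => ∑ i ∈ J, f i) g) :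
    psiW μ ν g = ∑' i, psiW μ ν (f i) := by
  simp only [psiW]
  rw [lintegral_congr_ae (h.ae_le (ae_ofReal_eq_tsum_of_isLUB hf hg)), lintegral_tsum fun i =>
    (Lp.stronglyMeasurable (f i)).measurable.ennreal_ofReal.aemeasurable]

theorem isWeight_psiW (h : ν ≪ μ) : IsWeight μ (psiW μ ν) := by
  refine ⟨fun f g hf hg => ?_, fun t f hf => ?_⟩
  · simp only [psiW]
    rw [← lintegral_add_left (Lp.stronglyMeasurable f).measurable.ennreal_ofReal]
    refine lintegral_congr_ae (h.ae_le ?_)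
    filter_upwards [Lp.coeFn_add f g, (Lp.coeFn_nonneg f).2 hf, (Lp.coeFn_nonneg g).2 hg]
      with x h₁ h₂ h₃
    rw [h₁, Pi.add_apply, ENNReal.ofReal_add h₂ h₃]
  · simp only [psiW]
    rw [← lintegral_const_mul _ (Lp.stronglyMeasurable f).measurable.ennreal_ofReal]
    refine lintegral_congr_ae (h.ae_le ?_)
    filter_upwards [Lp.coeFn_smul (t : ℝ) f] with x h₁
    rw [h₁, Pi.smul_apply, smul_eq_mul, ENNReal.ofReal_mul t.coe_nonneg, ENNReal.ofReal_coe_nnreal]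

theorem countablyAdditiveWeight_psiW (h : ν ≪ μ) : CountablyAdditiveWeight μ (psiW μ ν) :=
  fun _ hf _ _ hg => psiW_eq_tsum_of_isLUB h hf hg

theorem faithfulWeight_psiW_iff (h : ν ≪ μ) : FaithfulWeight μ (psiW μ ν) ↔ μ ≪ ν := by
  refine ⟨fun hfaith => Measure.AbsolutelyContinuous.mk fun E hE hνE => ?_, fun h' f hf h₀ => ?_⟩
  · rw [← indicatorLp_eq_zero_iff hE]
    exact hfaith _ (indicatorLp_nonneg hE) ((psiW_indicatorLp h hE).trans hνE)
  · rw [psiW, lintegral_eq_zero_iff (Lp.stronglyMeasurable f).measurable.ennreal_ofReal] at h₀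
    rw [Lp.eq_zero_iff_ae_eq_zero]
    filter_upwards [h'.ae_le h₀, (Lp.coeFn_nonneg f).2 hf] with x h₁ h₂
    exact le_antisymm (ENNReal.ofReal_eq_zero.1 h₁) h₂

theorem completelyAdditiveWeight_psiW (h : ν ≪ μ) (h' : μ ≪ ν) :
    CompletelyAdditiveWeight μ (psiW μ ν) := by
  classical
  intro ι f hf _ g hg
  by_cases htop : ∑' i, psiW μ ν (f i) = ∞
  · rw [htop, ← top_le_iff, ← htop, ENNReal.tsum_eq_iSup_sum]
    refine iSup_le fun J => ?_
    have hsum : ∑ i ∈ J, psiW μ ν (f i) = psiW μ ν (∑ i ∈ J, f i) := by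
      induction J using Finset.induction_on with
      | empty => simp [(isWeight_psiW h).map_zero]
      | insert a s ha ih =>
        rw [Finset.sum_insert ha, Finset.sum_insert ha, ih,
          (isWeight_psiW h).1 _ _ (hf a) (Finset.sum_nonneg fun i _ => hf i)]
    rw [hsum]
    refine lintegral_mono_ae (h.ae_le ?_)
    filter_upwards [(Lp.coeFn_le _ _).2 (hg.1 ⟨J, rfl⟩)] with x hx
    exact ENNReal.ofReal_le_ofReal hx
  · set s := Function.support fun i => psiW μ ν (f i)
    have : Countable s := (Summable.countable_support_ennreal htop).to_subtype
    have hzero : ∀ i ∉ s, f i = 0 := fun i hi =>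
      (faithfulWeight_psiW_iff h).2 h' (f i) (hf i) (Function.notMem_support.1 hi)
    have hrange : (Set.range fun J : Finset s => ∑ i ∈ J, f i) =
        Set.range fun J : Finset ι => ∑ i ∈ J, f i := by
      ext k
      constructor
      · rintro ⟨J, rfl⟩
        exact ⟨J.map (Function.Embedding.subtype _), by simp⟩
      · rintro ⟨J, rfl⟩
        refine ⟨J.subtype (· ∈ s), ?_⟩
        simp only
        rw [Finset.sum_subtype_eq_sum_filter]
        exact Finset.sum_filter_of_ne fun i _ hi => by_contra fun his => hi (hzero i his)
    rw [psiW_eq_tsum_of_isLUB h (fun i : s => hf i) (hrange ▸ hg)]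
    exact tsum_subtype_eq_of_support_subset (f := fun i => psiW μ ν (f i)) subset_rfl

/-- The measure `E ↦ ω(1_E)` associated with a countably additive weight. -/
def weightMeasure {ω : Lp ℝ ∞ μ → ℝ≥0∞} (hω : IsWeight μ ω)
    (hσ : CountablyAdditiveWeight μ ω) : Measure X :=
  Measure.ofMeasurable (fun E hE => ω (indicatorLp μ E hE))
    (by rw [(indicatorLp_eq_zero_iff _).2 measure_empty, hω.map_zero])
    (by
      intro E hE hdisj
      refine hσ.eq_tsum (fun i => indicatorLp_nonneg (hE i)) (indicatorLp_nonneg _) ?_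
      filter_upwards [ofReal_indicatorLp (μ := μ) (MeasurableSet.iUnion hE),
        ae_all_iff.2 fun i => ofReal_indicatorLp (μ := μ) (hE i)] with x h₁ h₂
      simp only [h₁, h₂]
      simpa only [Measure.dirac_apply' x (MeasurableSet.iUnion hE), Measure.dirac_apply' x (hE _)]
        using measure_iUnion (μ := Measure.dirac x) hdisj hE)

section weightMeasure

variable {ω : Lp ℝ ∞ μ → ℝ≥0∞} (hω : IsWeight μ ω) (hσ : CountablyAdditiveWeight μ ω)

theorem weightMeasure_apply {E : Set X} (hE : MeasurableSet E) :
    weightMeasure hω hσ E = ω (indicatorLp μ E hE) :=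
  Measure.ofMeasurable_apply E hE

theorem weightMeasure_absolutelyContinuous : weightMeasure hω hσ ≪ μ :=
  Measure.AbsolutelyContinuous.mk fun E hE h => by
    rw [weightMeasure_apply hω hσ hE, (indicatorLp_eq_zero_iff hE).2 h, hω.map_zero]

theorem lintegral_weightMeasure_simpleFunc (φ : SimpleFunc X ℝ≥0) :
    ∫⁻ x, φ x ∂weightMeasure hω hσ = ω (simpleLp μ φ) := by
  induction φ using SimpleFunc.induction with
  | const c hE =>
    rename_i E
    rw [simpleLp_piecewise_const, hω.2 _ _ (indicatorLp_nonneg hE),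
      ← weightMeasure_apply hω hσ hE, ← lintegral_indicator_const hE]
    refine lintegral_congr fun x => ?_
    by_cases h : x ∈ E <;> simp [h]
  | add _ hφ hψ =>
    rw [simpleLp_add, hω.1 _ _ (simpleLp_nonneg _) (simpleLp_nonneg _), ← hφ, ← hψ,
      ← lintegral_add_left (SimpleFunc.measurable _).coe_nnreal_ennreal]
    simp

theorem eq_psiW_weightMeasure {f : Lp ℝ ∞ μ} (hf : 0 ≤ f) :
    ω f = psiW μ (weightMeasure hω hσ) f := by
  have hmeas := (Lp.stronglyMeasurable f).measurable.ennreal_ofReal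
  have hdecomp := SimpleFunc.tsum_eapproxDiff _ hmeas
  set φ := SimpleFunc.eapproxDiff fun x => ENNReal.ofReal (f x)
  have hae : ∀ᵐ x ∂μ, ENNReal.ofReal (f x) = ∑' n, ENNReal.ofReal (simpleLp μ (φ n) x) := by
    filter_upwards [ae_all_iff.2 fun n => ofReal_simpleLp (μ := μ) (φ n)] with x hx
    rw [← hdecomp x]
    exact tsum_congr fun n => (hx n).symm
  calc ω f = ∑' n, ω (simpleLp μ (φ n)) := hσ.eq_tsum (fun n => simpleLp_nonneg _) hf hae
    _ = ∑' n, ∫⁻ x, φ n x ∂weightMeasure hω hσ := by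
      simp_rw [lintegral_weightMeasure_simpleFunc]
    _ = ∫⁻ x, ∑' n, (φ n x : ℝ≥0∞) ∂weightMeasure hω hσ := (lintegral_tsum fun n =>
      (SimpleFunc.measurable _).coe_nnreal_ennreal.aemeasurable).symm
    _ = psiW μ (weightMeasure hω hσ) f := lintegral_congr hdecomp

end weightMeasure

end Paper

/-- Let `(X,Σ,μ)` be a measure space and `M = L∞(X,Σ,μ)`.
(a) Every countably additive weight `ω` on `M₊` is of the form `ψ_ν(f) = ∫ f dν` for a
measure `ν ≪ μ`.  (b) The assignment `ν ↦ ψ_ν` is a bijection between measures `ν ≪ μ`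
and countably additive weights on `M₊` (each `ψ_ν` is a countably additive weight, the
assignment is injective, and surjective by (a)).  (c) `ψ_ν` is faithful iff `μ ≪ ν`, and
in that case `ψ_ν` is completely additive. -/
theorem weight_measure_correspondence
    {X : Type} [MeasurableSpace X] (μ : Measure X) :
    -- (a): every countably additive weight comes from a measure `ν ≪ μ`
    (∀ ω : Lp ℝ ∞ μ → ENNReal, IsWeight μ ω → CountablyAdditiveWeight μ ω →
      ∃ ν : Measure X, ν ≪ μ ∧ ∀ f : Lp ℝ ∞ μ, 0 ≤ f → ω f = psiW μ ν f) ∧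
    -- (b) well-definedness: each `ψ_ν` is a countably additive weight
    (∀ ν : Measure X, ν ≪ μ →
      IsWeight μ (psiW μ ν) ∧ CountablyAdditiveWeight μ (psiW μ ν)) ∧
    -- (b) injectivity
    (∀ ν₁ ν₂ : Measure X, ν₁ ≪ μ → ν₂ ≪ μ →
      (∀ f : Lp ℝ ∞ μ, 0 ≤ f → psiW μ ν₁ f = psiW μ ν₂ f) → ν₁ = ν₂) ∧
    -- (c)
    (∀ ν : Measure X, ν ≪ μ →
      (FaithfulWeight μ (psiW μ ν) ↔ μ ≪ ν) ∧
      (μ ≪ ν → CompletelyAdditiveWeight μ (psiW μ ν))) := by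
  exact ⟨fun ω hω hσ => ⟨weightMeasure hω hσ, weightMeasure_absolutelyContinuous hω hσ,
      fun f hf => eq_psiW_weightMeasure hω hσ hf⟩,
    fun ν h => ⟨isWeight_psiW h, countablyAdditiveWeight_psiW h⟩,
    fun ν₁ ν₂ h₁ h₂ h => Measure.ext fun E hE => by
      rw [← psiW_indicatorLp h₁ hE, ← psiW_indicatorLp h₂ hE, h _ (indicatorLp_nonneg hE)],
    fun ν h => ⟨faithfulWeight_psiW_iff h, completelyAdditiveWeight_psiW h⟩⟩
end
end

section
/- (Bade) Let H be a Hilbert space and let P be a set of orthogonal projections on H containing 0, closed under complement p ↦ 1 − p, closed under products (so pq = qp ∈ P for all p, q ∈ P; thus P is a Boolean algebra of projections), and order-closed: the supremum (equivalently, the strong-operator limit) in B(H) of every increasing net of projections from P again belongs to P. Then the norm-closed unital *-subalgebra of B(H) generated by P is a von Neumann algebra, and its set of projections is exactly P. -/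
noncomputable section

namespace Paper

variable {H : Type} [NormedAddCommGroup H] [InnerProductSpace ℂ H] [CompleteSpace H]

/-- An orthogonal projection on the Hilbert space `H`: a self-adjoint idempotent
bounded operator. -/
def IsProj (p : H →L[ℂ] H) : Prop := IsSelfAdjoint p ∧ IsIdempotentElem p

/-- The order on (commuting) projections: `p ≼ q` iff `q p = p`. -/
def ProjLE (p q : H →L[ℂ] H) : Prop := q * p = p

end Paper

open Paper

open ContinuousLinearMap

namespace Paper

section Simple

variable {H : Type} [NormedAddCommGroup H] [InnerProductSpace ℂ H]

/-- Finite linear combinations of orthogonal members of `P`, built by successive splitting. -/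
inductive IsSimple (P : Set (H →L[ℂ] H)) : (H →L[ℂ] H) → Prop
  | const (c : ℂ) : IsSimple P (c • 1)
  | split {p a b : H →L[ℂ] H} (hp : p ∈ P) (ha : IsSimple P a) (hb : IsSimple P b) :
      IsSimple P (p * a + (1 - p) * b)

namespace IsSimple

variable {P : Set (H →L[ℂ] H)}

lemma mem {p : H →L[ℂ] H} (hp : p ∈ P) : IsSimple P p := by
  simpa using split hp (const 1) (const 0)

lemma add {a b : H →L[ℂ] H} (ha : IsSimple P a) (hb : IsSimple P b) : IsSimple P (a + b) := by
  induction ha with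
  | const c =>
    induction hb with
    | const d => rw [← add_smul]; exact const _
    | @split p a b hp _ _ iha ihb =>
      convert! split hp iha ihb using 1
      simp only [mul_add, sub_mul, mul_smul_comm, mul_one, one_mul]
      module
  | @split p a a' hp _ _ iha ihb =>
    convert! split hp iha ihb using 1
    noncomm_ring

lemma smul (c : ℂ) {a : H →L[ℂ] H} (ha : IsSimple P a) : IsSimple P (c • a) := by
  induction ha with
  | const d => rw [smul_smul]; exact const _
  | split hp _ _ iha ihb =>
    rw [smul_add, ← mul_smul_comm, ← mul_smul_comm]
    exact split hp iha ihb

lemma mul {a b : H →L[ℂ] H} (ha : IsSimple P a) (hb : IsSimple P b) : IsSimple P (a * b) := by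
  induction ha with
  | const c => rw [smul_mul_assoc, one_mul]; exact hb.smul c
  | split hp _ _ iha ihb =>
    rw [add_mul, mul_assoc, mul_assoc]
    exact split hp iha ihb

end IsSimple

end Simple

variable {H : Type} [NormedAddCommGroup H] [InnerProductSpace ℂ H] [CompleteSpace H]

lemma isProj_starProjection (K : Submodule ℂ H) [K.HasOrthogonalProjection] :
    IsProj K.starProjection :=
  ⟨isSelfAdjoint_starProjection K, K.isIdempotentElem_starProjection⟩

lemma IsProj.one_sub {p : H →L[ℂ] H} (hp : IsProj p) : IsProj (1 - p) :=
  ⟨(IsSelfAdjoint.one _).sub hp.1, hp.2.one_sub⟩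

lemma IsProj.norm_apply_le {p : H →L[ℂ] H} (hp : IsProj p) (x : H) : ‖p x‖ ≤ ‖x‖ := by
  have h : IsStarProjection p := ⟨hp.2, hp.1⟩
  calc ‖p x‖ ≤ ‖p‖ * ‖x‖ := p.le_opNorm x
    _ ≤ 1 * ‖x‖ := by gcongr; exact h.norm_le
    _ = ‖x‖ := one_mul _

lemma IsProj.norm_add_sq {p : H →L[ℂ] H} (hp : IsProj p) (u v : H) :
    ‖p u + (1 - p) v‖ ^ 2 = ‖p u‖ ^ 2 + ‖(1 - p) v‖ ^ 2 := by
  have h : inner ℂ (p u) ((1 - p) v) = 0 := by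
    rw [← adjoint_inner_right, ← star_eq_adjoint, hp.1.star_eq, ← mul_apply_eq_comp, mul_sub, mul_one,
      hp.2.eq, sub_self, zero_apply, inner_zero_right]
  simpa only [sq] using norm_add_sq_eq_norm_sq_add_norm_sq_of_inner_eq_zero _ _ h

/-- A projection onto a subspace invariant under `r` and `star r` commutes with `r`. -/
lemma commute_starProjection {K : Submodule ℂ H} [K.HasOrthogonalProjection] {r : H →L[ℂ] H}
    (h : ∀ v ∈ K, r v ∈ K) (h' : ∀ v ∈ K, star r v ∈ K) : Commute r K.starProjection := by
  have key : ∀ t : H →L[ℂ] H, (∀ v ∈ K, t v ∈ K) →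
      K.starProjection * t * K.starProjection = t * K.starProjection := by
    intro t ht
    ext v
    exact K.starProjection_eq_self_iff.2 (ht _ (K.starProjection_apply_mem v))
  have h1 := key r h
  have h2 := congrArg star (key _ h')
  simp only [star_mul, star_star, (isSelfAdjoint_starProjection K).star_eq] at h2
  exact h1.symm.trans ((mul_assoc _ _ _).trans h2)

/-- The range projection of the positive part of a self-adjoint operator. -/
lemma exists_isProj_mul_eq_posPart {S : H →L[ℂ] H} (hS : IsSelfAdjoint S) :
    ∃ f : H →L[ℂ] H, IsProj f ∧ f * S = S⁺ ∧
      ∀ r, Commute r S → Commute (star r) S → Commute r f := by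
  let K : Submodule ℂ H := LinearMap.ker (S⁺ : H →L[ℂ] H).toLinearMap
  have hK : IsClosed (K : Set H) := (S⁺ : H →L[ℂ] H).isClosed_ker
  have : CompleteSpace K := hK.completeSpace_coe
  have hk := isProj_starProjection K
  have h1 : S⁺ * K.starProjection = 0 := by
    ext v
    exact K.starProjection_apply_mem v
  have h2 : K.starProjection * S⁺ = 0 := by
    have := congrArg star h1
    simpa [hk.1.star_eq, (CFC.posPart_nonneg S).isSelfAdjoint.star_eq] using this
  have h3 : K.starProjection * S⁻ = S⁻ := by
    ext v
    refine K.starProjection_eq_self_iff.2 ?_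
    change (S⁺ * S⁻) v = 0
    rw [CFC.posPart_mul_negPart, zero_apply]
  have key : ∀ r, Commute r S → ∀ v ∈ K, r v ∈ K := by
    intro r hr v hv
    have hc : Commute r S⁺ := by
      rw [CFC.posPart_def]
      exact (hr.symm.cfcₙ_real _).symm
    change (S⁺ * r) v = 0
    rw [← hc.eq, mul_apply_eq_comp, show S⁺ v = 0 from hv, map_zero]
  refine ⟨1 - K.starProjection, hk.one_sub, ?_, fun r hr hr' ↦ ?_⟩
  · conv_lhs => rw [← CFC.posPart_sub_negPart S hS]
    rw [sub_mul, one_mul, mul_sub, h2, h3]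
    abel
  · exact (Commute.one_right r).sub_right (commute_starProjection (key r hr) (key _ hr'))

/-- One step of the dyadic expansion of a positive operator in terms of projections. -/
lemma exists_isProj_halving {T : H →L[ℂ] H} {d : ℝ} (h0 : 0 ≤ T) (hd : T ≤ (2 * d) • 1) :
    ∃ f : H →L[ℂ] H, IsProj f ∧ (∀ r, Commute r T → Commute (star r) T → Commute r f) ∧
      0 ≤ T - d • f ∧ T - d • f ≤ d • 1 := by
  have hT : IsSelfAdjoint T := h0.isSelfAdjoint
  have hS : IsSelfAdjoint (T - d • 1) :=
    hT.sub ((IsSelfAdjoint.all d).smul (IsSelfAdjoint.one (H →L[ℂ] H)))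
  obtain ⟨f, hf, hfS, hcomm⟩ := exists_isProj_mul_eq_posPart hS
  have hsub : ∀ r : H →L[ℂ] H, Commute r T → Commute r (T - d • 1) := fun r hr ↦
    hr.sub_right ((Commute.one_right r).smul_right d)
  have hcomm' : ∀ r, Commute r T → Commute (star r) T → Commute r f := fun r h h' ↦
    hcomm r (hsub r h) (hsub _ h')
  have hTf : Commute T f := hcomm' T (Commute.refl T) (by rw [hT.star_eq])
  have hp := CFC.posPart_nonneg (T - d • 1)
  have hn := CFC.negPart_nonneg (T - d • 1)
  have hpn := CFC.posPart_sub_negPart (T - d • 1) hS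
  rw [← hfS] at hp hpn
  have hfSe : f * (T - d • 1) = f * T - d • f := by rw [mul_sub, mul_smul_comm, mul_one]
  rw [hfSe] at hp hpn
  have hff : f * f = f := hf.2
  refine ⟨f, hf, hcomm', ?_, ?_⟩
  · have h1 := star_left_conjugate_nonneg h0 (1 - f)
    have h2 : star (1 - f) * T * (1 - f) = T - f * T := by
      rw [hf.one_sub.1.star_eq, mul_assoc, mul_sub, mul_one, hTf.eq, sub_mul, one_mul,
        mul_sub, ← mul_assoc, hff, sub_self, sub_zero]
    rw [h2] at h1
    convert add_nonneg hp h1 using 1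
    abel
  · rw [← sub_nonneg]
    have h1 := star_left_conjugate_nonneg (sub_nonneg.2 hd) f
    have h2 : star f * ((2 * d) • 1 - T) * f = (2 * d) • f - f * T := by
      rw [hf.1.star_eq, mul_assoc, sub_mul, hTf.eq, mul_sub, ← mul_assoc f f T, hff,
        smul_mul_assoc, one_mul, mul_smul_comm, hff]
    rw [h2] at h1
    rw [sub_eq_iff_eq_add] at hpn
    have h3 := add_nonneg hn h1
    rw [← sub_eq_iff_eq_add'.2 hpn] at h3
    convert h3 using 1
    module

/-- An order-closed Boolean algebra of projections. -/
structure IsOrderClosedBoolean (P : Set (H →L[ℂ] H)) : Prop where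
  isProj : ∀ p ∈ P, IsProj p
  zero_mem : 0 ∈ P
  compl_mem : ∀ p ∈ P, 1 - p ∈ P
  commute : ∀ p ∈ P, ∀ q ∈ P, Commute p q
  mul_mem : ∀ p ∈ P, ∀ q ∈ P, p * q ∈ P
  sup_mem : ∀ s ⊆ P, s.Nonempty → DirectedOn ProjLE s → ∀ T, IsProj T →
    (∀ p ∈ s, ProjLE p T) → (∀ T', IsProj T' → (∀ p ∈ s, ProjLE p T') → ProjLE T T') → T ∈ P

namespace IsOrderClosedBoolean

variable {P : Set (H →L[ℂ] H)}

lemma one_mem (hP : IsOrderClosedBoolean P) : 1 ∈ P := by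
  simpa using hP.compl_mem 0 hP.zero_mem

lemma join_mem (hP : IsOrderClosedBoolean P) {p q : H →L[ℂ] H} (hp : p ∈ P) (hq : q ∈ P) :
    p + (1 - p) * q ∈ P := by
  have h : p + (1 - p) * q = 1 - (1 - p) * (1 - q) := by noncomm_ring
  rw [h]
  exact hP.compl_mem _ (hP.mul_mem _ (hP.compl_mem _ hp) _ (hP.compl_mem _ hq))

lemma projLE_join_left (hP : IsOrderClosedBoolean P) {p q : H →L[ℂ] H} (hp : p ∈ P)
    (hq : q ∈ P) : ProjLE p (p + (1 - p) * q) := by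
  have h : p * p = p := (hP.isProj p hp).2
  rw [ProjLE, add_mul, mul_assoc, (hP.commute q hq p hp).eq, ← mul_assoc, sub_mul, one_mul, h,
    sub_self, zero_mul, add_zero]

lemma projLE_join_right (hP : IsOrderClosedBoolean P) {p q : H →L[ℂ] H} (hq : q ∈ P) :
    ProjLE q (p + (1 - p) * q) := by
  have h : q * q = q := (hP.isProj q hq).2
  rw [ProjLE, add_mul, mul_assoc, h, sub_mul, one_mul, add_sub_cancel]

/-- A set closed under joins is directed. -/
lemma directedOn (hP : IsOrderClosedBoolean P) {s : Set (H →L[ℂ] H)} (hs : s ⊆ P)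
    (h : ∀ p ∈ s, ∀ q ∈ s, p + (1 - p) * q ∈ s) : DirectedOn ProjLE s := fun p hp q hq ↦
  ⟨_, h p hp q hq, hP.projLE_join_left (hs hp) (hs hq), hP.projLE_join_right (hs hq)⟩

/-- A directed subset has a supremum in `P`, which is also its strong limit. -/
lemma exists_sup (hP : IsOrderClosedBoolean P) {s : Set (H →L[ℂ] H)} (hs : s ⊆ P)
    (hne : s.Nonempty) (hdir : DirectedOn ProjLE s) :
    ∃ T ∈ P, (∀ p ∈ s, T * p = p) ∧ ∀ v, ∀ ε > 0, ∃ p ∈ s, ‖T v - p v‖ < ε := by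
  let L : Submodule ℂ H := ⨆ p : s, LinearMap.range (p : H →L[ℂ] H).toLinearMap
  have : Nonempty s := hne.to_subtype
  have hL : ∀ v, v ∈ L ↔ ∃ p ∈ s, p v = v := by
    intro v
    have hd : Directed (· ≤ ·) fun p : s ↦ LinearMap.range (p : H →L[ℂ] H).toLinearMap := by
      rintro ⟨p, hp⟩ ⟨q, hq⟩
      obtain ⟨r, hr, hpr, hqr⟩ := hdir p hp q hq
      refine ⟨⟨r, hr⟩, ?_, ?_⟩
      · rintro _ ⟨v, rfl⟩
        exact ⟨p v, DFunLike.congr_fun hpr v⟩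
      · rintro _ ⟨v, rfl⟩
        exact ⟨q v, DFunLike.congr_fun hqr v⟩
    rw [Submodule.mem_iSup_of_directed _ hd]
    constructor
    · rintro ⟨⟨p, hp⟩, w, rfl⟩
      exact ⟨p, hp, DFunLike.congr_fun (hP.isProj p (hs hp)).2 w⟩
    · rintro ⟨p, hp, hv⟩
      exact ⟨⟨p, hp⟩, v, hv⟩
  let M := L.topologicalClosure
  have hM : CompleteSpace M := L.isClosed_topologicalClosure.completeSpace_coe
  have hub : ∀ p ∈ s, M.starProjection * p = p := by
    intro p hp
    ext v
    refine M.starProjection_eq_self_iff.2 (L.le_topologicalClosure ((hL _).2 ⟨p, hp, ?_⟩))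
    exact DFunLike.congr_fun (hP.isProj p (hs hp)).2 v
  refine ⟨M.starProjection, ?_, hub, ?_⟩
  · refine hP.sup_mem s hs hne hdir _ (isProj_starProjection M) hub fun T' _ hT' ↦ ?_
    have hcl : IsClosed {v : H | T' v = v} := isClosed_eq T'.continuous continuous_id
    have hsub : (L : Set H) ⊆ {v : H | T' v = v} := by
      intro v hv
      obtain ⟨p, hp, hpv⟩ := (hL v).1 hv
      have := DFunLike.congr_fun (hT' p hp) v
      rwa [mul_apply_eq_comp, hpv] at this
    ext v
    exact closure_minimal hsub hcl (M.starProjection_apply_mem v)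
  · intro v ε hε
    obtain ⟨w, hw, hvw⟩ := Metric.mem_closure_iff.1 (M.starProjection_apply_mem v) ε hε
    obtain ⟨p, hp, hpw⟩ := (hL w).1 hw
    refine ⟨p, hp, lt_of_le_of_lt ?_ hvw⟩
    have hpT : p * M.starProjection = p := by
      have := congrArg star (hub p hp)
      rwa [star_mul, (hP.isProj p (hs hp)).1.star_eq, (isSelfAdjoint_starProjection M).star_eq]
        at this
    have h : M.starProjection v - p v = (1 - p) (M.starProjection v - w) := by
      have := DFunLike.congr_fun hpT v
      rw [mul_apply_eq_comp] at this
      simp [this, hpw]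
    rw [h, dist_eq_norm]
    exact (hP.isProj p (hs hp)).one_sub.norm_apply_le _

end IsOrderClosedBoolean

namespace IsSimple

variable {P : Set (H →L[ℂ] H)}

lemma commute (hP : IsOrderClosedBoolean P) {p a : H →L[ℂ] H} (hp : p ∈ P)
    (ha : IsSimple P a) : Commute p a := by
  induction ha with
  | const c => exact (Commute.one_right p).smul_right c
  | split hq _ _ iha ihb =>
    have h := hP.commute p hp _ hq
    exact (h.mul_right iha).add_right (((Commute.one_right p).sub_right h).mul_right ihb)

lemma star (hP : IsOrderClosedBoolean P) {a : H →L[ℂ] H} (ha : IsSimple P a) :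
    IsSimple P (star a) := by
  induction ha with
  | const c => rw [star_smul, star_one]; exact const _
  | @split p a b hp _ _ iha ihb =>
    rw [star_add, star_mul, star_mul, (hP.isProj p hp).1.star_eq,
      (hP.isProj p hp).one_sub.1.star_eq, ← (iha.commute hP hp).eq,
      ← (ihb.commute hP (hP.compl_mem p hp)).eq]
    exact split hp iha ihb

lemma of_mem_adjoin (hP : IsOrderClosedBoolean P) {a : H →L[ℂ] H}
    (ha : a ∈ StarAlgebra.adjoin ℂ P) : IsSimple P a := by
  induction ha using StarAlgebra.adjoin_induction with
  | mem p hp => exact mem hp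
  | algebraMap c => rw [Algebra.algebraMap_eq_smul_one]; exact const c
  | add _ _ _ _ ha hb => exact ha.add hb
  | mul _ _ _ _ ha hb => exact ha.mul hb
  | star _ _ ha => exact ha.star hP

/-- A Chebyshev-type estimate: the members of `P` cut out by `|a| ≥ 1/2`. -/
lemma exists_mem_norm_le (hP : IsOrderClosedBoolean P) {a : H →L[ℂ] H} (ha : IsSimple P a) :
    ∃ e ∈ P, ∀ x, ‖(1 - e) x‖ ≤ 2 * ‖(a - 1) x‖ ∧ ‖e x‖ ≤ 2 * ‖a x‖ := by
  induction ha with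
  | const c =>
    by_cases hc : 1 / 2 ≤ ‖c‖
    · refine ⟨1, hP.one_mem, fun x ↦ ⟨by simp, ?_⟩⟩
      rw [smul_apply, norm_smul]
      nlinarith [norm_nonneg ((1 : H →L[ℂ] H) x)]
    · refine ⟨0, hP.zero_mem, fun x ↦ ⟨?_, by simp⟩⟩
      have h1 : (c • 1 - 1 : H →L[ℂ] H) x = (c - 1) • x := by simp [sub_smul]
      have h2 : (1 : ℝ) ≤ ‖c - 1‖ + ‖c‖ := by
        have := norm_sub_le c (c - 1)
        rw [sub_sub_cancel, norm_one] at this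
        linarith
      rw [h1, norm_smul, sub_zero, one_apply_eq_self]
      nlinarith [norm_nonneg x]
  | @split p a b hp ha hb iha ihb =>
    obtain ⟨e, he, h⟩ := iha
    obtain ⟨f, hf, h'⟩ := ihb
    have hpp := hP.isProj p hp
    have hsplit : ∀ (s t u w : H →L[ℂ] H), Commute p s → Commute p t → Commute p u → Commute p w →
        (∀ x, ‖s x‖ ≤ 2 * ‖u x‖) → (∀ x, ‖t x‖ ≤ 2 * ‖w x‖) →
        ∀ x, ‖(p * s + (1 - p) * t) x‖ ≤ 2 * ‖(p * u + (1 - p) * w) x‖ := by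
      intro s t u w hs ht hu hw hsu htw x
      have aux : ∀ y : H →L[ℂ] H, Commute p y → Commute (1 - p) y := fun y hy ↦
        (Commute.one_left y).sub_left hy
      have e1 := hpp.norm_add_sq (s x) (t x)
      have e2 := hpp.norm_add_sq (u x) (w x)
      have i1 := hsu (p x)
      have i2 := htw ((1 - p) x)
      simp only [← mul_apply_eq_comp, ← hs.eq, ← hu.eq, ← (aux t ht).eq, ← (aux w hw).eq]
        at i1 i2 e1 e2
      rw [← add_apply] at e1 e2
      refine abs_le_of_sq_le_sq' ?_ (by positivity) |>.2
      have j1 := pow_le_pow_left₀ (norm_nonneg _) i1 2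
      have j2 := pow_le_pow_left₀ (norm_nonneg _) i2 2
      rw [e1, mul_pow, e2]
      linarith
    have hc1 := hP.commute p hp e he
    have hc2 := hP.commute p hp f hf
    have hc3 := ha.commute hP hp
    have hc4 := hb.commute hP hp
    have aux : ∀ y : H →L[ℂ] H, Commute p y → Commute p (1 - y) ∧ Commute p (y - 1) := fun y hy ↦
      ⟨(Commute.one_right p).sub_right hy, hy.sub_right (Commute.one_right p)⟩
    have hmem : p * e + (1 - p) * f ∈ P := by
      have h0 : p * e * ((1 - p) * f) = 0 := by
        rw [hc1.eq, mul_assoc, ← mul_assoc p, mul_sub, mul_one, hpp.2.eq, sub_self, zero_mul,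
          mul_zero]
      convert! hP.join_mem (hP.mul_mem p hp e he) (hP.mul_mem _ (hP.compl_mem p hp) f hf) using 1
      rw [sub_mul 1 (p * e), one_mul, h0, sub_zero]
    refine ⟨p * e + (1 - p) * f, hmem, fun x ↦ ⟨?_, ?_⟩⟩
    · have := hsplit _ _ _ _ (aux e hc1).1 (aux f hc2).1 (aux a hc3).2 (aux b hc4).2
        (fun x ↦ (h x).1) (fun x ↦ (h' x).1) x
      convert! this using 3
      · noncomm_ring
      · noncomm_ring
    · exact hsplit _ _ _ _ hc1 hc2 hc3 hc4 (fun x ↦ (h x).2) (fun x ↦ (h' x).2) x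

end IsSimple

namespace IsOrderClosedBoolean

variable {P : Set (H →L[ℂ] H)}

/-- If members of `P` separate `x` from `y` approximately, they do so exactly at `x`. -/
lemma exists_mem_apply_eq_self_norm_le (hP : IsOrderClosedBoolean P) {x y : H}
    (h : ∀ ε > 0, ∃ p ∈ P, ‖(1 - p) x‖ ≤ ε ∧ ‖p y‖ ≤ ε) {ε : ℝ} (hε : 0 < ε) :
    ∃ u ∈ P, u x = x ∧ ‖u y‖ ≤ ε := by
  have hpos : ∀ n : ℕ, 0 < ε / 4 * (1 / 2) ^ n := fun n ↦ by positivity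
  choose p hp hpx hpy using fun n : ℕ ↦ h _ (hpos n)
  let f : ℕ → (H →L[ℂ] H) := fun n ↦ Nat.rec (p 0) (fun n g ↦ g + (1 - g) * p (n + 1)) n
  have hf : ∀ n, f n ∈ P := by
    intro n
    induction n with
    | zero => exact hp 0
    | succ n ih => exact hP.join_mem ih (hp _)
  have hle : ∀ m n, m ≤ n → ProjLE (f m) (f n) := by
    intro m n hmn
    induction n, hmn using Nat.le_induction with
    | base => exact (hP.isProj _ (hf m)).2
    | succ n _ ih =>
      have h1 := hP.projLE_join_left (hf n) (hp (n + 1))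
      have h2 : f (n + 1) * f n = f n := h1
      rw [ProjLE] at ih ⊢
      rw [← ih, ← mul_assoc, h2]
  have hpf : ∀ n, f n * p n = p n := by
    intro n
    cases n with
    | zero => exact (hP.isProj _ (hp 0)).2
    | succ n => exact hP.projLE_join_right (hp (n + 1))
  have hfy : ∀ n, ‖f n y‖ ≤ ε / 2 - ε / 4 * (1 / 2) ^ n := by
    intro n
    induction n with
    | zero => have := hpy 0; norm_num at this ⊢; change ‖p 0 y‖ ≤ _; linarith
    | succ n ih =>
      have h1 : f (n + 1) y = f n y + p (n + 1) ((1 - f n) y) := by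
        rw [← mul_apply_eq_comp, (hP.commute _ (hp (n + 1)) _ (hP.compl_mem _ (hf n))).eq]
        rfl
      have h2 : p (n + 1) ((1 - f n) y) = (1 - f n) (p (n + 1) y) := by
        rw [← mul_apply_eq_comp, (hP.commute _ (hp (n + 1)) _ (hP.compl_mem _ (hf n))).eq]
        rfl
      have h3 := (hP.isProj _ (hf n)).one_sub.norm_apply_le (p (n + 1) y)
      have h4 := norm_add_le (f n y) ((1 - f n) (p (n + 1) y))
      have h5 := hpy (n + 1)
      rw [h1, h2]
      rw [pow_succ] at h5 ⊢
      linarith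
  obtain ⟨u, hu, huf, hlim⟩ := hP.exists_sup (s := Set.range f) (Set.range_subset_iff.2 hf)
    (Set.range_nonempty f) (by
      rintro _ ⟨m, rfl⟩ _ ⟨n, rfl⟩
      exact ⟨f (max m n), ⟨_, rfl⟩, hle _ _ (le_max_left _ _), hle _ _ (le_max_right _ _)⟩)
  refine ⟨u, hu, ?_, ?_⟩
  · have hb : ∀ n : ℕ, ‖(1 - u) x‖ ≤ ε / 4 * (1 / 2) ^ n := by
      intro n
      have h1 : u * p n = p n := by
        rw [← hpf n, ← mul_assoc, huf _ ⟨n, rfl⟩]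
      have h2 : (1 - u) x = (1 - u) ((1 - p n) x) := by
        have : (1 - u) * (1 - p n) = 1 - u := by
          rw [mul_sub, mul_one, sub_mul 1 u, h1, one_mul, sub_self, sub_zero]
        rw [← mul_apply_eq_comp, this]
      rw [h2]
      exact ((hP.isProj _ hu).one_sub.norm_apply_le _).trans (hpx n)
    have ht : Filter.Tendsto (fun n : ℕ ↦ ε / 4 * (1 / 2 : ℝ) ^ n) Filter.atTop (nhds 0) := by
      simpa using (tendsto_pow_atTop_nhds_zero_of_lt_one (r := (1 / 2 : ℝ)) (by norm_num)
        (by norm_num)).const_mul (ε / 4)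
    have h0 := norm_le_zero_iff.1 (ge_of_tendsto' ht hb)
    exact (sub_eq_zero.1 h0).symm
  · obtain ⟨_, ⟨n, rfl⟩, hn⟩ := hlim y (ε / 2) (by positivity)
    have h1 := norm_le_norm_add_norm_sub (f n y) (u y)
    have h2 := hfy n
    have h3 := hpos n
    rw [norm_sub_rev] at h1
    linarith

/-- Each vector has a smallest member of `P` fixing it. -/
lemma exists_carrier (hP : IsOrderClosedBoolean P) (x : H) :
    ∃ e ∈ P, e x = x ∧ ∀ u ∈ P, u x = x → e * u = e := by
  obtain ⟨T, hT, hub, hlim⟩ := hP.exists_sup (s := {p ∈ P | p x = 0}) (fun p hp ↦ hp.1)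
    ⟨0, hP.zero_mem, rfl⟩ (hP.directedOn (fun p hp ↦ hp.1) fun p hp q hq ↦
      ⟨hP.join_mem hp.1 hq.1, by simp [hp.2, hq.2]⟩)
  have hTx : T x = 0 := by
    by_contra hne
    obtain ⟨p, hp, hlt⟩ := hlim x _ (norm_pos_iff.2 hne)
    rw [hp.2, sub_zero] at hlt
    exact lt_irrefl _ hlt
  refine ⟨1 - T, hP.compl_mem T hT, by simp [hTx], fun u hu hux ↦ ?_⟩
  have h := hub (1 - u) ⟨hP.compl_mem u hu, by simp [hux]⟩
  have h' : (1 - T) * (1 - u) = 0 := by rw [sub_mul, one_mul, h, sub_self]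
  rwa [mul_sub, mul_one, sub_eq_zero, eq_comm] at h'

/-- A projection in the bicommutant is approximated at each vector by the generated algebra. -/
lemma exists_adjoin_apply_near (hP : IsOrderClosedBoolean P) {q : H →L[ℂ] H}
    (hq : q ∈ Set.centralizer (Set.centralizer P)) (z : H) {ε : ℝ} (hε : 0 < ε) :
    ∃ a ∈ StarAlgebra.adjoin ℂ P, ‖q z - a z‖ < ε := by
  let L : Submodule ℂ H := (StarAlgebra.adjoin ℂ P).toSubalgebra.toSubmodule.map
    (ContinuousLinearMap.apply ℂ H z).toLinearMap
  let K := L.topologicalClosure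
  have hK : CompleteSpace K := L.isClosed_topologicalClosure.completeSpace_coe
  have hinv : ∀ p ∈ P, ∀ v ∈ K, p v ∈ K := by
    intro p hp v hv
    refine map_mem_closure p.continuous hv ?_
    rintro _ ⟨a, ha, rfl⟩
    exact ⟨p * a, MulMemClass.mul_mem (s := StarAlgebra.adjoin ℂ P)
      (StarAlgebra.subset_adjoin ℂ P hp) ha, rfl⟩
  have hz : z ∈ K := L.le_topologicalClosure ⟨1, OneMemClass.one_mem (StarAlgebra.adjoin ℂ P), rfl⟩
  have hcomm : K.starProjection ∈ Set.centralizer P := fun p hp ↦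
    commute_starProjection (hinv p hp) (by rw [(hP.isProj p hp).1.star_eq]; exact hinv p hp)
  have hqz : q z ∈ K := by
    have := DFunLike.congr_fun (hq _ hcomm) z
    rw [mul_apply_eq_comp, mul_apply_eq_comp, K.starProjection_eq_self_iff.2 hz] at this
    exact K.starProjection_eq_self_iff.1 this
  obtain ⟨_, ⟨a, ha, rfl⟩, hlt⟩ := Metric.mem_closure_iff.1 hqz ε hε
  exact ⟨a, ha, by rwa [dist_eq_norm] at hlt⟩

lemma subset_centralizer (hP : IsOrderClosedBoolean P) : P ⊆ Set.centralizer P :=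
  fun p hp q hq ↦ hP.commute q hq p hp

lemma coe_bicommutant (hP : IsOrderClosedBoolean P) :
    (StarSubalgebra.centralizer ℂ (StarSubalgebra.centralizer ℂ P : Set (H →L[ℂ] H)) :
      Set (H →L[ℂ] H)) = Set.centralizer (Set.centralizer P) := by
  have h : P ∪ star P = P := by
    refine Set.union_eq_self_of_subset_right fun p hp ↦ ?_
    have := (hP.isProj _ hp).1.star_eq
    rw [star_star] at this
    rw [this]
    exact hp
  rw [StarSubalgebra.coe_centralizer_centralizer, h]

lemma adjoin_le_bicommutant (hP : IsOrderClosedBoolean P) :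
    ((StarAlgebra.adjoin ℂ P).topologicalClosure : Set (H →L[ℂ] H)) ⊆
      Set.centralizer (Set.centralizer P) := by
  rw [← hP.coe_bicommutant]
  refine StarSubalgebra.topologicalClosure_minimal
    (StarAlgebra.adjoin_le_centralizer_centralizer ℂ P) ?_
  rw [hP.coe_bicommutant]
  exact Set.isClosed_centralizer _

/-- Every projection in the bicommutant of `P` belongs to `P`. -/
lemma mem_of_mem_bicommutant (hP : IsOrderClosedBoolean P) {q : H →L[ℂ] H} (hq : IsProj q)
    (hqP : q ∈ Set.centralizer (Set.centralizer P)) : q ∈ P := by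
  have hcomm : ∀ p ∈ P, Commute p q := fun p hp ↦ hqP p (hP.subset_centralizer hp)
  have hacomm : ∀ a ∈ StarAlgebra.adjoin ℂ P, Commute a q := fun a ha ↦
    hqP a (Set.centralizer_subset hP.subset_centralizer
      (hP.adjoin_le_bicommutant (StarSubalgebra.le_topologicalClosure _ ha)))
  have hsep : ∀ x y, q x = x → q y = 0 → ∀ ε > 0, ∃ p ∈ P, ‖(1 - p) x‖ ≤ ε ∧ ‖p y‖ ≤ ε := by
    intro x y hx hy ε hε
    obtain ⟨a, ha, hlt⟩ := hP.exists_adjoin_apply_near hqP (x + y) (half_pos hε)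
    obtain ⟨e, he, h⟩ := (IsSimple.of_mem_adjoin hP ha).exists_mem_norm_le hP
    have hqa : ∀ v, q (a v) = a (q v) := fun v ↦ DFunLike.congr_fun (hacomm a ha).eq.symm v
    have h1 : q (q (x + y) - a (x + y)) = -((a - 1) x) := by
      rw [map_sub, hqa]
      simp [hx, hy]
    have h2 : (1 - q) (q (x + y) - a (x + y)) = -(a y) := by
      simp [hqa, hx, hy]
    have h3 := hq.norm_apply_le (q (x + y) - a (x + y))
    have h4 := hq.one_sub.norm_apply_le (q (x + y) - a (x + y))
    rw [h1, norm_neg] at h3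
    rw [h2, norm_neg] at h4
    exact ⟨e, he, by linarith [(h x).1], by linarith [(h y).2]⟩
  have hcar : ∀ x, q x = x → ∃ p ∈ P, q * p = p ∧ p x = x := by
    intro x hx
    obtain ⟨e, he, hex, hmin⟩ := hP.exists_carrier x
    refine ⟨e, he, ?_, hex⟩
    have hy : ∀ y, q y = 0 → e y = 0 := by
      intro y hy
      refine norm_le_zero_iff.1 (le_of_forall_pos_le_add fun ε hε ↦ ?_)
      obtain ⟨u, hu, hux, huy⟩ := hP.exists_mem_apply_eq_self_norm_le (hsep x y hx hy) hε
      rw [← hmin u hu hux, mul_apply_eq_comp, zero_add]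
      exact ((hP.isProj e he).norm_apply_le _).trans huy
    rw [← (hcomm e he).eq]
    ext v
    have h1 := hy (v - q v) (by rw [map_sub, ← mul_apply_eq_comp, hq.2.eq, sub_self])
    rw [map_sub, sub_eq_zero] at h1
    exact h1.symm
  obtain ⟨T, hT, hub, hlim⟩ := hP.exists_sup (s := {p ∈ P | q * p = p}) (fun p hp ↦ hp.1)
    ⟨0, hP.zero_mem, mul_zero q⟩ (hP.directedOn (fun p hp ↦ hp.1) fun p hp r hr ↦
      ⟨hP.join_mem hp.1 hr.1, by
        rw [mul_add, hp.2, sub_mul, one_mul, mul_sub, hr.2, ← mul_assoc, hp.2]⟩)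
  have hTq : T * q = q := by
    ext v
    obtain ⟨p, hp, hqp, hpv⟩ := hcar (q v) (DFunLike.congr_fun hq.2 v)
    have := DFunLike.congr_fun (hub p ⟨hp, hqp⟩) (q v)
    rwa [mul_apply_eq_comp, hpv] at this
  have hqT : q * T = T := by
    ext v
    refine (sub_eq_zero.1 (norm_le_zero_iff.1 (le_of_forall_pos_le_add fun ε hε ↦ ?_))).symm
    obtain ⟨p, hp, hlt⟩ := hlim v ε hε
    have h1 : T v - (q * T) v = (1 - q) (T v - p v) := by
      have := DFunLike.congr_fun hp.2 v
      rw [mul_apply_eq_comp] at this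
      simp [this]
    rw [h1, zero_add]
    exact (hq.one_sub.norm_apply_le _).trans hlt.le
  rwa [← hTq, (hcomm T hT).eq, hqT]

/-- Positive elements of the bicommutant are norm limits from the generated algebra. -/
lemma mem_closure_of_nonneg (hP : IsOrderClosedBoolean P) {T : H →L[ℂ] H}
    (hT : T ∈ Set.centralizer (Set.centralizer P)) {c : ℝ} (h0 : 0 ≤ T) (hc : T ≤ c • 1) :
    T ∈ (StarAlgebra.adjoin ℂ P).topologicalClosure := by
  have hstar : ∀ r ∈ Set.centralizer P, star r ∈ Set.centralizer P := by
    intro r hr p hp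
    have := congrArg star (hr p hp)
    rw [star_mul, star_mul, (hP.isProj p hp).1.star_eq] at this
    exact this.symm
  have hstep : ∀ n : ℕ, ∃ v ∈ StarAlgebra.adjoin ℂ P, 0 ≤ T - v ∧
      T - v ≤ (c * (1 / 2) ^ n) • (1 : H →L[ℂ] H) := by
    intro n
    induction n with
    | zero => exact ⟨0, ZeroMemClass.zero_mem _, by simpa using h0, by simpa using hc⟩
    | succ n ih =>
      obtain ⟨v, hv, hv0, hvc⟩ := ih
      have hd : c * (1 / 2) ^ n = 2 * (c * (1 / 2) ^ (n + 1)) := by ring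
      rw [hd] at hvc
      obtain ⟨f, hf, hfc, hf0, hf1⟩ := exists_isProj_halving hv0 hvc
      have hvB := hP.adjoin_le_bicommutant (StarSubalgebra.le_topologicalClosure _ hv)
      have hcom : ∀ r ∈ Set.centralizer P, Commute r (T - v) := fun r hr ↦
        Commute.sub_right (hT r hr) (hvB r hr)
      have hfP : f ∈ P := hP.mem_of_mem_bicommutant hf fun r hr ↦
        hfc r (hcom r hr) (hcom _ (hstar r hr))
      refine ⟨v + (c * (1 / 2) ^ (n + 1)) • f, add_mem hv ?_, ?_, ?_⟩
      · rw [← Complex.coe_smul]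
        exact SMulMemClass.smul_mem _ (StarAlgebra.subset_adjoin ℂ P hfP)
      · rwa [← sub_sub]
      · rwa [← sub_sub]
  have hc0 : Filter.Tendsto (fun n : ℕ ↦ c * (1 / 2 : ℝ) ^ n) Filter.atTop (nhds 0) := by
    simpa using (tendsto_pow_atTop_nhds_zero_of_lt_one (r := (1 / 2 : ℝ)) (by norm_num)
      (by norm_num)).const_mul c
  refine Metric.mem_closure_iff.2 fun ε hε ↦ ?_
  obtain ⟨n, hn⟩ := ((tendsto_order.1 hc0).2 ε hε).exists
  obtain ⟨v, hv, hv0, hvc⟩ := hstep n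
  refine ⟨v, hv, ?_⟩
  rw [dist_eq_norm]
  refine lt_of_le_of_lt ?_ (max_lt hn hε)
  refine (CStarAlgebra.norm_le_iff_le_algebraMap _ (le_max_right _ _) hv0).2 ?_
  rw [Algebra.algebraMap_eq_smul_one]
  refine hvc.trans ?_
  rw [← sub_nonneg, ← sub_smul]
  exact smul_nonneg (sub_nonneg.2 (le_max_left _ _)) zero_le_one

lemma bicommutant_eq (hP : IsOrderClosedBoolean P) :
    Set.centralizer (Set.centralizer P) =
      ((StarAlgebra.adjoin ℂ P).topologicalClosure : Set (H →L[ℂ] H)) := by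
  refine Set.Subset.antisymm (fun T hT ↦ ?_) hP.adjoin_le_bicommutant
  let B := StarSubalgebra.centralizer ℂ (StarSubalgebra.centralizer ℂ P : Set (H →L[ℂ] H))
  have hB : ∀ S, S ∈ B ↔ S ∈ Set.centralizer (Set.centralizer P) := fun S ↦ by
    rw [← hP.coe_bicommutant]; rfl
  have hsa : ∀ S ∈ B, IsSelfAdjoint S → S ∈ (StarAlgebra.adjoin ℂ P).topologicalClosure := by
    intro S hS hSA
    have h1 : ∀ c : ℝ, algebraMap ℝ (H →L[ℂ] H) c = algebraMap ℂ _ (c : ℂ) := fun c ↦ by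
      simp [Algebra.algebraMap_eq_smul_one]
    have hmem : S + algebraMap ℝ _ ‖S‖ ∈ (StarAlgebra.adjoin ℂ P).topologicalClosure := by
      refine hP.mem_closure_of_nonneg (c := 2 * ‖S‖) ((hB _).1 ?_) ?_ ?_
      · rw [h1]
        exact add_mem hS (algebraMap_mem B _)
      · rw [← neg_le_iff_add_nonneg]
        exact hSA.neg_algebraMap_norm_le_self
      · have := add_le_add_left hSA.le_algebraMap_norm_self (algebraMap ℝ _ ‖S‖)
        rw [two_mul, ← Algebra.algebraMap_eq_smul_one, map_add]
        exact this
    have := sub_mem hmem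
      (algebraMap_mem (StarAlgebra.adjoin ℂ P).topologicalClosure (‖S‖ : ℂ))
    rwa [h1, add_sub_cancel_right] at this
  have hTB : T ∈ B := (hB T).2 hT
  have hmem : (realPart T : H →L[ℂ] H) ∈ B ∧ (imaginaryPart T : H →L[ℂ] H) ∈ B := by
    rw [realPart_apply_coe, imaginaryPart_apply_coe]
    simp only [← Complex.coe_smul (2⁻¹ : ℝ)]
    exact ⟨SMulMemClass.smul_mem _ (add_mem hTB (star_mem hTB)),
      SMulMemClass.smul_mem _ (SMulMemClass.smul_mem _ (sub_mem hTB (star_mem hTB)))⟩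
  rw [← realPart_add_I_smul_imaginaryPart T]
  exact add_mem (hsa _ hmem.1 (realPart T).2) (SMulMemClass.smul_mem _
    (hsa _ hmem.2 (imaginaryPart T).2))

end IsOrderClosedBoolean

end Paper

/-- **Bade.** Let `P` be a Boolean algebra of orthogonal projections on
a Hilbert space `H` (containing `0`, closed under complementation and products) which
is order-closed: the supremum (in the projection lattice of `B(H)`) of every increasing
net (upward-directed subset) of projections from `P` belongs to `P`.  Then the
norm-closed unital *-subalgebra of `B(H)` generated by `P` is a von Neumann algebra
whose set of projections is exactly `P`. -/
theorem bade_boolean_algebra_of_projections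
    {H : Type} [NormedAddCommGroup H] [InnerProductSpace ℂ H] [CompleteSpace H]
    (P : Set (H →L[ℂ] H))
    (hproj : ∀ p ∈ P, IsProj p)
    (hzero : (0 : H →L[ℂ] H) ∈ P)
    (hcompl : ∀ p ∈ P, (1 : H →L[ℂ] H) - p ∈ P)
    (hmul : ∀ p ∈ P, ∀ q ∈ P, p * q = q * p ∧ p * q ∈ P)
    (horder : ∀ s ⊆ P, s.Nonempty → DirectedOn ProjLE s →
      ∀ T : H →L[ℂ] H, IsProj T → (∀ p ∈ s, ProjLE p T) →
        (∀ T' : H →L[ℂ] H, IsProj T' → (∀ p ∈ s, ProjLE p T') → ProjLE T T') →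
        T ∈ P) :
    (∃ W : VonNeumannAlgebra H,
      (W : Set (H →L[ℂ] H)) =
        ((StarAlgebra.adjoin ℂ P).topologicalClosure : Set (H →L[ℂ] H))) ∧
    {T : H →L[ℂ] H | T ∈ (StarAlgebra.adjoin ℂ P).topologicalClosure ∧ IsProj T} = P := by
  have hP : IsOrderClosedBoolean P :=
    { isProj := hproj
      zero_mem := hzero
      compl_mem := hcompl
      commute := fun p hp q hq ↦ (hmul p hp q hq).1
      mul_mem := fun p hp q hq ↦ (hmul p hp q hq).2
      sup_mem := horder }
  have hbi := hP.bicommutant_eq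
  refine ⟨⟨⟨(StarAlgebra.adjoin ℂ P).topologicalClosure, ?_⟩, rfl⟩, ?_⟩
  · change Set.centralizer (Set.centralizer
      ((StarAlgebra.adjoin ℂ P).topologicalClosure : Set (H →L[ℂ] H))) =
        ((StarAlgebra.adjoin ℂ P).topologicalClosure : Set (H →L[ℂ] H))
    rw [← hbi, Set.centralizer_centralizer_centralizer]
  · ext T
    constructor
    · rintro ⟨hT, hTp⟩
      exact hP.mem_of_mem_bicommutant hTp (hP.adjoin_le_bicommutant hT)
    · intro hT
      exact ⟨StarSubalgebra.le_topologicalClosure _ (StarAlgebra.subset_adjoin ℂ P hT),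
        hproj T hT⟩
end
end
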